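/- For each integer k ≥ 2 and any class 𝒢 of groups containing at least one of the cyclic groups ℤ₃, ℤ₅, …, ℤ_{2k−1}, the wheel W_{2k} and the doubled circle 2C_{2k} are both bad with respect to 𝒢; in particular, if ℤ_{2k−1} ∈ 𝒢 then the basis of Z₁(W_{2k}; ℤ₂) consisting of the 2k Hamiltonian circles of W_{2k} can be balanced in an unbalanced gain graph on W_{2k} with gain group ℤ_{2k−1}, and similarly for 2C_{2k}. -/

import Mathlib

set_option maxHeartbeats 1000000
set_option synthInstance.maxHeartbeats 400000

attribute [local instance] Classical.propDecidable

noncomputable section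

/-- A multigraph: loops and multiple edges are allowed.  Each edge `e` has a
reference orientation, from `src e` to `tgt e`. -/
structure MGraph : Type 1 where
  V : Type
  E : Type
  src : E → V
  tgt : E → V

/-- A class of groups (a property of groups). -/
abbrev GroupClass : Type 1 := (G : Type) → Group G → Prop

/-- A subgroup-closed class of groups. -/
def SubgroupClosed (𝒢 : GroupClass) : Prop :=
  ∀ (G : Type) [instG : Group G], 𝒢 G instG → ∀ H : Subgroup G, 𝒢 H inferInstance

/-- The number of occurrences of `a` in the list `l`. -/
def countIn {α : Type} (l : List α) (a : α) : ℕ :=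
  (l.map fun x => if x = a then 1 else 0).sum

namespace MGraph

/-- A step of a walk: an edge together with a direction of traversal
(`true` = from `src` to `tgt`). -/
abbrev Step (Γ : MGraph) : Type := Γ.E × Bool

def stepStart (Γ : MGraph) (s : Γ.Step) : Γ.V := if s.2 then Γ.src s.1 else Γ.tgt s.1

def stepEnd (Γ : MGraph) (s : Γ.Step) : Γ.V := if s.2 then Γ.tgt s.1 else Γ.src s.1

/-- `IsWalkFrom Γ a b l`: the list of steps `l` is a walk from `a` to `b`. -/
inductive IsWalkFrom (Γ : MGraph) : Γ.V → Γ.V → List Γ.Step → Prop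
  | nil (v : Γ.V) : IsWalkFrom Γ v v []
  | cons {a b : Γ.V} {s : Γ.Step} {l : List Γ.Step} :
      Γ.stepStart s = a → IsWalkFrom Γ (Γ.stepEnd s) b l → IsWalkFrom Γ a b (s :: l)

section Walks

variable (Γ : MGraph)

/-- The list of edges underlying a walk. -/
def walkEdges (l : List Γ.Step) : List Γ.E := l.map Prod.fst

/-- The list of vertices visited by a walk starting at `a`. -/
def walkVerts (a : Γ.V) (l : List Γ.Step) : List Γ.V := a :: l.map Γ.stepEnd

/-- A closed walk (given as its list of steps) is simple if it is nontrivial and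
repeats no edge and no vertex (except that initial vertex = final vertex). -/
def IsSimpleClosed (l : List Γ.Step) : Prop :=
  l ≠ [] ∧ (Γ.walkEdges l).Nodup ∧ (l.map Γ.stepStart).Nodup

section Gain

variable {G : Type} [Group G]

/-- The gain of a single step, for a gain function `g`. -/
def stepGain (g : Γ.E → G) (s : Γ.Step) : G := if s.2 then g s.1 else (g s.1)⁻¹

/-- The gain of a walk: the product of the gains of its steps, in order. -/
def walkGain (g : Γ.E → G) (l : List Γ.Step) : G := (l.map (Γ.stepGain g)).prod

/-- A gain graph is balanced if every simple closed walk has gain `1`. -/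
def IsBalanced (g : Γ.E → G) : Prop :=
  ∀ (v : Γ.V) (l : List Γ.Step),
    Γ.IsWalkFrom v v l → Γ.IsSimpleClosed l → Γ.walkGain g l = 1

end Gain

/-- The mod-2 boundary map from edge chains to vertex chains. -/
def boundary : (Γ.E →₀ ZMod 2) →ₗ[ZMod 2] (Γ.V →₀ ZMod 2) :=
  Finsupp.lsum (ZMod 2) fun e => Finsupp.lsingle (Γ.src e) + Finsupp.lsingle (Γ.tgt e)

/-- The binary cycle space `Z₁(Γ; ℤ₂)`: mod-2 edge chains with even degree at
every vertex. -/
def cycleSpace : Submodule (ZMod 2) (Γ.E →₀ ZMod 2) := LinearMap.ker Γ.boundary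

/-- `B` is a basis of the binary cycle space of `Γ`. -/
def IsCycleBasis (B : Set (Γ.E →₀ ZMod 2)) : Prop :=
  (∀ c ∈ B, c ∈ Γ.cycleSpace) ∧
  LinearIndependent (ZMod 2) (fun c : B => c.1) ∧
  ∀ c ∈ Γ.cycleSpace, c ∈ Submodule.span (ZMod 2) B

/-- The closed walk `l` is a cyclic orientation of the binary cycle `c`:
it is closed and its edge multiplicities reduced mod 2 give `c`. -/
def IsCyclicOrientation (c : Γ.E →₀ ZMod 2) (l : List Γ.Step) : Prop :=
  (∃ v, Γ.IsWalkFrom v v l) ∧ ∀ e : Γ.E, c e = (countIn (Γ.walkEdges l) e : ZMod 2)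

/-- The binary cycle `c` is a circle: it is the (indicator of the) edge set of a
simple closed walk. -/
def IsCircleCycle (c : Γ.E →₀ ZMod 2) : Prop :=
  ∃ l, Γ.IsSimpleClosed l ∧ Γ.IsCyclicOrientation c l

section Tests

variable {G : Type} [Group G]

/-- `B` passes the Binary Cycle Test: it has a cyclic orientation all of whose
closed walks have gain `1`. -/
def PassesBCT (g : Γ.E → G) (B : Set (Γ.E →₀ ZMod 2)) : Prop :=
  ∀ c ∈ B, ∃ l, Γ.IsCyclicOrientation c l ∧ Γ.walkGain g l = 1

/-- The Binary Cycle Test is valid for the gain graph `(Γ, g, G)`. -/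
def BCTValid (g : Γ.E → G) : Prop :=
  (∃ B, Γ.IsCycleBasis B ∧ Γ.PassesBCT g B) → Γ.IsBalanced g

/-- `c` is a circle whose natural traversal as a simple closed walk has gain 1. -/
def IsBalancedCircleCycle (g : Γ.E → G) (c : Γ.E →₀ ZMod 2) : Prop :=
  ∃ l, Γ.IsSimpleClosed l ∧ Γ.IsCyclicOrientation c l ∧ Γ.walkGain g l = 1

/-- The Circle Test is valid for the gain graph `(Γ, g, G)`: if some basis of the
binary cycle space consists of balanced circles, then the gain graph is balanced. -/
def CircleTestValid (g : Γ.E → G) : Prop :=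
  (∃ B, Γ.IsCycleBasis B ∧ ∀ c ∈ B, Γ.IsBalancedCircleCycle g c) → Γ.IsBalanced g

end Tests

/-- The Binary Cycle Test is valid for `Γ` with respect to the class `𝒢`. -/
def BCTValidFor (𝒢 : GroupClass) : Prop :=
  ∀ (G : Type) [instG : Group G], 𝒢 G instG → ∀ g : Γ.E → G, Γ.BCTValid g

/-- The Circle Test is valid for `Γ` with respect to the class `𝒢`
(`Γ` is a "good" graph for `𝒢`). -/
def CircleTestValidFor (𝒢 : GroupClass) : Prop :=
  ∀ (G : Type) [instG : Group G], 𝒢 G instG → ∀ g : Γ.E → G, Γ.CircleTestValid g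

/-- Deletion of a set of edges. -/
def deleteEdges (S : Set Γ.E) : MGraph where
  V := Γ.V
  E := {e : Γ.E // e ∉ S}
  src e := Γ.src e.1
  tgt e := Γ.tgt e.1

/-- The relation identifying the two endpoints of each edge of `S`. -/
def contractRel (S : Set Γ.E) : Γ.V → Γ.V → Prop :=
  fun x y => ∃ e ∈ S, Γ.src e = x ∧ Γ.tgt e = y

/-- Contraction `Γ/S`: vertices in the same component of `(V, S)` are identified
and the edges of `S` are deleted. -/
def contract (S : Set Γ.E) : MGraph where
  V := Quot (Γ.contractRel S)
  E := {e : Γ.E // e ∉ S}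
  src e := Quot.mk _ (Γ.src e.1)
  tgt e := Quot.mk _ (Γ.tgt e.1)

/-- The subgraph with vertex set `U` and edge set the edges of `T` having both
endpoints in `U`. -/
def subgraph (U : Set Γ.V) (T : Set Γ.E) : MGraph where
  V := U
  E := {e : Γ.E // e ∈ T ∧ Γ.src e ∈ U ∧ Γ.tgt e ∈ U}
  src e := ⟨Γ.src e.1, e.2.2.1⟩
  tgt e := ⟨Γ.tgt e.1, e.2.2.2⟩

/-- The set of vertices incident with an edge of `D`. -/
def edgeVerts (D : Set Γ.E) : Set Γ.V := {x | ∃ e ∈ D, Γ.src e = x ∨ Γ.tgt e = x}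

/-- The subgraph spanned by an edge set `D`. -/
def edgeSubgraph (D : Set Γ.E) : MGraph := Γ.subgraph (Γ.edgeVerts D) D

/-- Adjacency of vertices. -/
def Adj (x y : Γ.V) : Prop :=
  ∃ e : Γ.E, (Γ.src e = x ∧ Γ.tgt e = y) ∨ (Γ.src e = y ∧ Γ.tgt e = x)

/-- A graph with no loops. -/
def Loopless : Prop := ∀ e : Γ.E, Γ.src e ≠ Γ.tgt e

/-- A finite graph. -/
def IsFiniteGraph : Prop := Finite Γ.V ∧ Finite Γ.E

/-- A graph is inseparable if any two distinct edges lie in a common circle. -/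
def Inseparable : Prop :=
  ∀ e f : Γ.E, e ≠ f →
    ∃ (v : Γ.V) (l : List Γ.Step), Γ.IsWalkFrom v v l ∧ Γ.IsSimpleClosed l ∧
      e ∈ Γ.walkEdges l ∧ f ∈ Γ.walkEdges l

/-- `D` is (the edge set of) a block of `Γ`: a maximal inseparable subgraph. -/
def IsBlock (D : Set Γ.E) : Prop :=
  (Γ.edgeSubgraph D).Inseparable ∧
  ∀ D', D ⊆ D' → (Γ.edgeSubgraph D').Inseparable → D' = D

/-- The edge set `D` is a circle of `Γ`. -/
def IsCircleSet (D : Set Γ.E) : Prop :=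
  ∃ (v : Γ.V) (l : List Γ.Step), Γ.IsWalkFrom v v l ∧ Γ.IsSimpleClosed l ∧
    D = {e | e ∈ Γ.walkEdges l}

/-- The edge set `D` is a balanced circle for the gain function `g`. -/
def IsBalancedCircleSet {G : Type} [Group G] (g : Γ.E → G) (D : Set Γ.E) : Prop :=
  Γ.IsCircleSet D ∧
  ∀ (v : Γ.V) (l : List Γ.Step), Γ.IsWalkFrom v v l → Γ.IsSimpleClosed l →
    D = {e | e ∈ Γ.walkEdges l} → Γ.walkGain g l = 1

end Walks

/-- An isomorphism of multigraphs (preserving endpoints as unordered pairs). -/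
structure Iso (Γ Δ : MGraph) where
  vEquiv : Γ.V ≃ Δ.V
  eEquiv : Γ.E ≃ Δ.E
  ends_eq : ∀ e : Γ.E,
    s(Δ.src (eEquiv e), Δ.tgt (eEquiv e)) = s(vEquiv (Γ.src e), vEquiv (Γ.tgt e))

/-- `Δ` is a minor of `Γ`: `Δ` is isomorphic to a subgraph of a contraction of `Γ`. -/
def IsMinor (Δ Γ : MGraph) : Prop :=
  ∃ (S : Set Γ.E) (U : Set (Γ.contract S).V) (T : Set (Γ.contract S).E),
    Nonempty (Iso Δ ((Γ.contract S).subgraph U T))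

/-- Subdivision of the edge `e₀` into a path of length two. -/
def subdivide (Γ : MGraph) (e₀ : Γ.E) : MGraph where
  V := Γ.V ⊕ Unit
  E := Γ.E ⊕ Unit
  src := fun e => match e with
    | .inl e => Sum.inl (Γ.src e)
    | .inr _ => Sum.inr ()
  tgt := fun e => match e with
    | .inl e => if e = e₀ then Sum.inr () else Sum.inl (Γ.tgt e)
    | .inr _ => Sum.inl (Γ.tgt e₀)

/-- One subdivision step (up to isomorphism). -/
def SubdivisionStep (A B : MGraph) : Prop :=
  Nonempty (Iso B A) ∨ ∃ e₀ : A.E, Nonempty (Iso B (A.subdivide e₀))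

/-- `Δ` is (isomorphic to) a graph obtained from `Γ₀` by subdividing edges. -/
def IsSubdivisionOf (Δ Γ₀ : MGraph) : Prop :=
  ∃ Δ', Relation.ReflTransGen SubdivisionStep Γ₀ Δ' ∧ Nonempty (Iso Δ Δ')

/-- Two graphs are homeomorphic if both are obtained by subdividing edges of a
common graph. -/
def Homeomorphic (Γ₁ Γ₂ : MGraph) : Prop :=
  ∃ Γ₀, IsSubdivisionOf Γ₁ Γ₀ ∧ IsSubdivisionOf Γ₂ Γ₀

section Ops

variable (Γ : MGraph)

/-- Interchange `u` and `v`. -/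
def twistVert (u v x : Γ.V) : Γ.V := if x = u then v else if x = v then u else x

/-- The result of twisting the edge set `A` across `{u, v}`: every endpoint of an
edge of `A` at `u` is reconnected to `v` and vice versa. -/
def twist (u v : Γ.V) (A : Set Γ.E) : MGraph where
  V := Γ.V
  E := Γ.E
  src e := if e ∈ A then Γ.twistVert u v (Γ.src e) else Γ.src e
  tgt e := if e ∈ A then Γ.twistVert u v (Γ.tgt e) else Γ.tgt e

/-- `x` and `y` are joined by a walk all of whose vertices avoid `u` and `v`. -/
def AvoidConn (u v x y : Γ.V) : Prop :=
  ∃ l, Γ.IsWalkFrom x y l ∧ ∀ z ∈ Γ.walkVerts x l, z ≠ u ∧ z ≠ v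

/-- `P` is the vertex set of a union of some, but not all, of the components of
`Γ ∖ {u, v}` (the data of a Whitney twist across the 2-separation `{u,v}`). -/
def IsWhitneyTwistData (u v : Γ.V) (P : Set Γ.V) : Prop :=
  (∀ x ∈ P, x ≠ u ∧ x ≠ v) ∧
  (∀ x ∈ P, ∀ y, Γ.AvoidConn u v x y → y ∈ P) ∧
  P.Nonempty ∧ (∃ y : Γ.V, y ∉ P ∧ y ≠ u ∧ y ≠ v)

/-- `(v, w, F)` is valid data for extruding the vertex `v`: `w` is a neighbor of
`v` and `F` is a nonempty set of edges joining `v` and `w`. -/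
def IsExtrusionData (v w : Γ.V) (F : Set Γ.E) : Prop :=
  v ≠ w ∧ F.Nonempty ∧
  ∀ e ∈ F, (Γ.src e = v ∧ Γ.tgt e = w) ∨ (Γ.src e = w ∧ Γ.tgt e = v)

/-- Extrusion of a new vertex `v′` from `v`: the edges of `F` are reattached to
join `v′` to `w`, and a new edge joins `v` to `v′`. -/
def extrude (v w : Γ.V) (F : Set Γ.E) : MGraph where
  V := Γ.V ⊕ Unit
  E := Γ.E ⊕ Unit
  src := fun e => match e with
    | .inl e => if e ∈ F ∧ Γ.src e = v then Sum.inr () else Sum.inl (Γ.src e)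
    | .inr _ => Sum.inl v
  tgt := fun e => match e with
    | .inl e => if e ∈ F ∧ Γ.tgt e = v then Sum.inr () else Sum.inl (Γ.tgt e)
    | .inr _ => Sum.inr ()

end Ops

/-- `Δ` is obtained from `Γ` by extruding a vertex (up to isomorphism). -/
def IsExtrusionOf (Δ Γ : MGraph) : Prop :=
  ∃ (v w : Γ.V) (F : Set Γ.E),
    Γ.IsExtrusionData v w F ∧ Nonempty (Iso Δ (Γ.extrude v w F))

/-- `Γ` is extrusion-irreducible: it is not obtainable by extrusion from a
smaller graph. -/
def ExtrusionIrreducible (Γ : MGraph) : Prop := ¬ ∃ Δ : MGraph, IsExtrusionOf Γ Δ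

/-- `Δ` is obtained from `Γ₀` by a (possibly empty) sequence of extrusions,
up to isomorphism. -/
def ObtainedByExtrusions (Δ Γ₀ : MGraph) : Prop :=
  ∃ Δ', Relation.ReflTransGen (fun A B => IsExtrusionOf B A) Γ₀ Δ' ∧ Nonempty (Iso Δ Δ')

section Bridges

variable (Γ : MGraph)

/-- The walk `l` is internally disjoint from `{u, v}`. -/
def IntDisjWalk (u v : Γ.V) (l : List Γ.Step) : Prop :=
  ∀ z ∈ (l.map Γ.stepEnd).dropLast, z ≠ u ∧ z ≠ v

/-- Two edges lie in a common walk internally disjoint from `{u, v}`. -/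
def InBridgeRel (u v : Γ.V) (e f : Γ.E) : Prop :=
  ∃ (a b : Γ.V) (l : List Γ.Step), Γ.IsWalkFrom a b l ∧ Γ.IntDisjWalk u v l ∧
    e ∈ Γ.walkEdges l ∧ f ∈ Γ.walkEdges l

/-- `D` is (the edge set of) a bridge of `{u, v}`: a maximal set of edges any two
of which lie in a common walk internally disjoint from `{u, v}`. -/
def IsBridge (u v : Γ.V) (D : Set Γ.E) : Prop :=
  D.Nonempty ∧ (∀ e ∈ D, ∀ f ∈ D, Γ.InBridgeRel u v e f) ∧
  ∀ D', D ⊆ D' → (∀ e ∈ D', ∀ f ∈ D', Γ.InBridgeRel u v e f) → D' = D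

/-- The set `A` of vertices is connected using only edges of `D`, within `A`. -/
def SetConnWith (D : Set Γ.E) (A : Set Γ.V) : Prop :=
  ∀ x ∈ A, ∀ y ∈ A, ∃ l, Γ.IsWalkFrom x y l ∧ (∀ s ∈ l, s.1 ∈ D) ∧
    ∀ z ∈ Γ.walkVerts x l, z ∈ A

/-- The subgraph with edge set `D` has `2P_{2uv}` (a four-circle with `u`, `v` as
opposite vertices) as a minor rooted at `u` and `v`, expressed by branch sets. -/
def HasRooted2P2Minor (u v : Γ.V) (D : Set Γ.E) : Prop :=
  ∃ β : Fin 4 → Set Γ.V,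
    (∀ i j, i ≠ j → Disjoint (β i) (β j)) ∧
    (∀ i, (β i).Nonempty ∧ Γ.SetConnWith D (β i)) ∧
    u ∈ β 0 ∧ v ∈ β 2 ∧
    ∀ i : Fin 4, ∃ e ∈ D,
      (Γ.src e ∈ β i ∧ Γ.tgt e ∈ β (i + 1)) ∨ (Γ.src e ∈ β (i + 1) ∧ Γ.tgt e ∈ β i)

/-- Removing the vertex `w` disconnects the subgraph with edge set `D`. -/
def SeparatesBridge (D : Set Γ.E) (w : Γ.V) : Prop :=
  ∃ x ∈ Γ.edgeVerts D, ∃ y ∈ Γ.edgeVerts D, x ≠ w ∧ y ≠ w ∧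
    ¬ ∃ l, Γ.IsWalkFrom x y l ∧ (∀ s ∈ l, s.1 ∈ D) ∧ ∀ z ∈ Γ.walkVerts x l, z ≠ w

end Bridges

/-! ### Particular graphs -/

/-- `K₁°`: one vertex with one loop. -/
@[reducible] def loopGraph : MGraph where
  V := Unit
  E := Unit
  src _ := ()
  tgt _ := ()

/-- `mK₂`: two vertices joined by `m` parallel edges. -/
@[reducible] def banana (m : ℕ) : MGraph where
  V := Bool
  E := Fin m
  src _ := false
  tgt _ := true

/-- `C_l(m₁, …, m_l)`: a circle of length `l` whose `i`-th edge is replaced by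
`m i` parallel copies. -/
@[reducible] def multiCircle (l : ℕ) (m : Fin l → ℕ) : MGraph where
  V := Fin l
  E := Σ i : Fin l, Fin (m i)
  src e := e.1
  tgt e := ⟨(e.1.1 + 1) % l, Nat.mod_lt _ e.1.pos⟩

/-- `2C_n`: the circle of length `n` with every edge doubled. -/
@[reducible] def twoCircle (n : ℕ) : MGraph := multiCircle n fun _ => 2

/-- `K₄(m, m′)`: `K₄` with two opposite (nonadjacent) edges replaced by `m` and
`m′` parallel copies respectively. -/
@[reducible] def K4m (m m' : ℕ) : MGraph where
  V := Fin 4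
  E := (Fin m ⊕ Fin m') ⊕ Fin 4
  src := fun e => match e with
    | .inl (.inl _) => 0
    | .inl (.inr _) => 2
    | .inr j => ![0, 0, 1, 1] j
  tgt := fun e => match e with
    | .inl (.inl _) => 1
    | .inl (.inr _) => 3
    | .inr j => ![2, 3, 2, 3] j

/-- `K₄''`: `K₄` with two adjacent edges doubled. -/
@[reducible] def K4dd : MGraph where
  V := Fin 4
  E := Fin 8
  src := ![0, 0, 0, 0, 0, 1, 1, 2]
  tgt := ![1, 1, 2, 2, 3, 2, 3, 3]

/-- The `n`-spoke wheel `W_n`: rim vertices `Fin n` and a hub; `inl i` is the rim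
edge from `v_i` to `v_{i+1}` and `inr i` is the spoke from the hub to `v_i`. -/
@[reducible] def wheel (n : ℕ) : MGraph where
  V := Fin n ⊕ Unit
  E := Fin n ⊕ Fin n
  src := fun e => match e with
    | .inl i => Sum.inl i
    | .inr _ => Sum.inr ()
  tgt := fun e => match e with
    | .inl i => Sum.inl ⟨(i.1 + 1) % n, Nat.mod_lt _ i.pos⟩
    | .inr i => Sum.inl i

instance (n : ℕ) : Finite ((wheel n).E) := inferInstanceAs (Finite (Fin n ⊕ Fin n))

/-- The indicator of an edge set, as a binary chain. -/
def indicatorCycle (Γ : MGraph) [Finite Γ.E] (D : Set Γ.E) : Γ.E →₀ ZMod 2 :=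
  Finsupp.equivFunOnFinite.symm fun e => if e ∈ D then 1 else 0

/-- The edge set of the Hamiltonian circle of `W_n` omitting the rim edge `r`:
all rim edges except `r`, together with the two spokes at the ends of `r`. -/
def wheelHamSet (n : ℕ) (r : Fin n) : Set (wheel n).E :=
  {e | Sum.elim (fun j : Fin n => j ≠ r)
      (fun j : Fin n => j = r ∨ j = ⟨(r.1 + 1) % n, Nat.mod_lt _ r.pos⟩) e}

/-- The set of (indicators of) the `n` Hamiltonian circles of the wheel `W_n`. -/
def wheelHamBasis (n : ℕ) : Set ((wheel n).E →₀ ZMod 2) :=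
  {c | ∃ r : Fin n, c = indicatorCycle (wheel n) (wheelHamSet n r)}

/-- A theta graph: a graph homeomorphic to a triple link. -/
def IsThetaGraph (Δ : MGraph) : Prop := Homeomorphic Δ (banana 3)

end MGraph

end
namespace MGraph

/-- The `i`-th vertex (mod `n`). -/
def cyc (n : ℕ) (hn : 0 < n) (i : ℕ) : Fin n := ⟨i % n, Nat.mod_lt _ hn⟩

lemma cyc_val (n : ℕ) (hn : 0 < n) (r : Fin n) : cyc n hn r.1 = r := by
  apply Fin.ext
  simp [cyc, Nat.mod_eq_of_lt r.2]

lemma cyc_inj (n : ℕ) (hn : 0 < n) (s : ℕ) {i j : ℕ} (hi : i < n) (hj : j < n)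
    (h : cyc n hn (s + i) = cyc n hn (s + j)) : i = j := by
  have h1 : (s + i) % n = (s + j) % n := congrArg Fin.val h
  have h2 : i ≡ j [MOD n] := Nat.ModEq.add_left_cancel' s h1
  have h3 : i % n = j % n := h2
  rwa [Nat.mod_eq_of_lt hi, Nat.mod_eq_of_lt hj] at h3

lemma cyc_bij (n : ℕ) (hn : 0 < n) (s : ℕ) :
    Function.Bijective (fun i : Fin n => cyc n hn (s + i.1)) := by
  rw [← Finite.injective_iff_bijective]
  intro i j h
  exact Fin.ext (cyc_inj n hn s i.2 j.2 h)

lemma cyc_next (n : ℕ) (hn : 0 < n) (i : ℕ) (h : 0 < n) :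
    (⟨((cyc n hn i).1 + 1) % n, Nat.mod_lt _ h⟩ : Fin n) = cyc n hn (i + 1) := by
  apply Fin.ext
  simp [cyc]

lemma cyc_last (n : ℕ) (hn : 0 < n) (r : Fin n) :
    cyc n hn (r.1 + 1 + (n - 1)) = r := by
  have : r.1 + 1 + (n - 1) = r.1 + n := by omega
  rw [this]
  apply Fin.ext
  simp [cyc, Nat.mod_eq_of_lt r.2]

lemma cyc_prod (n : ℕ) (hn : 0 < n) (s : ℕ) {M : Type} [CommGroup M] (f : Fin n → M) :
    ∏ i ∈ Finset.range n, f (cyc n hn (s + i)) = ∏ j, f j := by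
  rw [← (cyc_bij n hn s).prod_comp f, ← Fin.prod_univ_eq_prod_range (fun i => f (cyc n hn (s + i)))]

lemma cyc_ne_iff (n : ℕ) (hn : 0 < n) (r j : Fin n) :
    (∃ i, i < n - 1 ∧ cyc n hn (r.1 + 1 + i) = j) ↔ j ≠ r := by
  constructor
  · rintro ⟨i, hi, rfl⟩ h
    have h2 := h.trans (cyc_last n hn r).symm
    have := cyc_inj n hn _ (by omega) (by omega) h2
    omega
  · intro h
    obtain ⟨i, hi⟩ := (cyc_bij n hn (r.1 + 1)).2 j
    refine ⟨i.1, ?_, hi⟩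
    by_contra h3
    have h4 : i.1 = n - 1 := by omega
    simp only [h4, cyc_last] at hi
    exact h hi.symm

lemma list_prod_range {M : Type} [CommMonoid M] (f : ℕ → M) (L : ℕ) :
    ((List.range L).map f).prod = ∏ i ∈ Finset.range L, f i := by
  induction L with
  | zero => simp
  | succ L ih => rw [List.range_succ, Finset.prod_range_succ]; simp [ih]

section General

variable (Γ : MGraph)

lemma isWalk_snoc {a b : Γ.V} {l : List Γ.Step} {s : Γ.Step}
    (h : Γ.IsWalkFrom a b l) (hs : Γ.stepStart s = b) :
    Γ.IsWalkFrom a (Γ.stepEnd s) (l ++ [s]) := by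
  induction h with
  | nil v => exact IsWalkFrom.cons hs (IsWalkFrom.nil _)
  | cons h1 h2 ih => exact IsWalkFrom.cons h1 (ih hs)

lemma isWalk_range (v : ℕ → Γ.V) (st : ℕ → Γ.Step) (h1 : ∀ i, Γ.stepStart (st i) = v i)
    (h2 : ∀ i, Γ.stepEnd (st i) = v (i + 1)) (L : ℕ) :
    Γ.IsWalkFrom (v 0) (v L) ((List.range L).map st) := by
  induction L with
  | zero => exact IsWalkFrom.nil _
  | succ L ih =>
    rw [List.range_succ, List.map_append, ← h2]
    exact isWalk_snoc Γ ih (h1 L)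

lemma countIn_eq {α : Type} (l : List α) (hl : l.Nodup) (a : α) :
    countIn l a = if a ∈ l then 1 else 0 := by
  induction l with
  | nil => simp [countIn]
  | cons x l ih =>
    have h := ih (List.nodup_cons.1 hl).2
    have h0 := (List.nodup_cons.1 hl).1
    simp only [countIn, List.map_cons, List.sum_cons] at h ⊢
    rw [h]
    by_cases hx : x = a
    · subst hx
      simp [h0]
    · have : a ≠ x := fun h => hx h.symm
      simp [hx, this]

lemma orient_of [Finite Γ.E] (D : Set Γ.E) (l : List Γ.Step) (v : Γ.V)
    (hw : Γ.IsWalkFrom v v l) (hn : (Γ.walkEdges l).Nodup)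
    (hD : ∀ e, e ∈ D ↔ e ∈ Γ.walkEdges l) :
    Γ.IsCyclicOrientation (indicatorCycle Γ D) l := by
  refine ⟨⟨v, hw⟩, fun e => ?_⟩
  rw [countIn_eq _ hn]
  simp only [indicatorCycle, Finsupp.equivFunOnFinite_symm_apply_apply, hD]
  split_ifs <;> simp

lemma boundary_single (e : Γ.E) (x : ZMod 2) : Γ.boundary (Finsupp.single e x) =
    Finsupp.single (Γ.src e) x + Finsupp.single (Γ.tgt e) x := by
  simp [boundary]

lemma char2 {V : Type} (x : V →₀ ZMod 2) : x + x = 0 := by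
  ext e
  simp only [Finsupp.add_apply, Finsupp.zero_apply]
  exact CharTwo.add_self_eq_zero _

lemma boundary_walk {a b : Γ.V} {l : List Γ.Step} (h : Γ.IsWalkFrom a b l) :
    Γ.boundary ((l.map fun s => Finsupp.single s.1 (1 : ZMod 2)).sum) =
      Finsupp.single a 1 + Finsupp.single b 1 := by
  induction h with
  | nil v => simp [char2]
  | @cons a b s l h1 h2 ih =>
    have h3 : Finsupp.single (Γ.src s.1) (1 : ZMod 2) + Finsupp.single (Γ.tgt s.1) 1 =
        Finsupp.single a 1 + Finsupp.single (Γ.stepEnd s) 1 := by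
      subst h1
      rcases s with ⟨e, _ | _⟩
      · simp [stepStart, stepEnd, add_comm]
      · simp [stepStart, stepEnd]
    rw [List.map_cons, List.sum_cons, map_add, ih, boundary_single, h3, add_assoc,
      ← add_assoc (Finsupp.single (Γ.stepEnd s) (1 : ZMod 2)), char2, zero_add]

lemma mem_cycleSpace {c : Γ.E →₀ ZMod 2} {l : List Γ.Step}
    (h : Γ.IsCyclicOrientation c l) : c ∈ Γ.cycleSpace := by
  obtain ⟨⟨v, hv⟩, hc⟩ := h
  have : c = (l.map fun s => Finsupp.single s.1 (1 : ZMod 2)).sum := by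
    ext e
    rw [hc]
    clear hc hv
    induction l with
    | nil => simp [countIn, walkEdges]
    | cons s l ih =>
      simp only [countIn, walkEdges, List.map_cons, List.sum_cons, Finsupp.add_apply] at ih ⊢
      rw [← ih, Finsupp.single_apply]
      push_cast
      rfl
  rw [this, cycleSpace, LinearMap.mem_ker, boundary_walk Γ hv, char2]

lemma basis_of {ι : Type} [Fintype ι] (b : ι → (Γ.E →₀ ZMod 2))
    (ρ : (Γ.E →₀ ZMod 2) →ₗ[ZMod 2] (ι → ZMod 2))
    (hb : ∀ i, b i ∈ Γ.cycleSpace)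
    (hρ : ∀ c ∈ Γ.cycleSpace, ρ c = 0 → c = 0)
    (hli : LinearIndependent (ZMod 2) (fun i => ρ (b i))) :
    Γ.IsCycleBasis (Set.range b) := by
  refine ⟨?_, ?_, ?_⟩
  · rintro _ ⟨i, rfl⟩
    exact hb i
  · have : LinearIndependent (ZMod 2) b := LinearIndependent.of_comp ρ hli
    exact this.linearIndepOn_id
  · intro c hc
    have hspan : Submodule.span (ZMod 2) (Set.range (fun i => ρ (b i))) = ⊤ :=
      hli.span_eq_top_of_card_eq_finrank' (by simp)
    have h1 : ρ c ∈ Submodule.span (ZMod 2) (Set.range (fun i => ρ (b i))) := by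
      rw [hspan]; trivial
    have h2 : Set.range (fun i => ρ (b i)) = ρ '' Set.range b := by
      rw [← Set.range_comp]; rfl
    rw [h2, Submodule.span_image] at h1
    obtain ⟨d, hd, hdc⟩ := h1
    have hdZ : d ∈ Γ.cycleSpace := by
      refine Submodule.span_le.2 ?_ hd
      rintro _ ⟨i, rfl⟩
      exact hb i
    have h3 := hρ (c - d) (Submodule.sub_mem _ hc hdZ) (by rw [map_sub, hdc, sub_self])
    rw [sub_eq_zero.1 h3]
    exact hd

end General

lemma sum_le_card (n m : ℕ) (hm : m < n) {M : Type} [AddCommMonoid M] (x : M) :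
    ∑ j : Fin n, (if j.1 ≤ m then x else 0) = (m + 1) • x := by
  rw [Fin.sum_univ_eq_sum_range (fun j => if j ≤ m then x else 0), ← Finset.sum_filter,
    Finset.sum_const]
  congr 1
  have : Finset.filter (fun j => j ≤ m) (Finset.range n) = Finset.range (m + 1) := by
    ext j
    simp only [Finset.mem_filter, Finset.mem_range]
    omega
  rw [this, Finset.card_range]

/-- The key matrix. -/
def keyM (n m : ℕ) (r j : Fin n) : ZMod 2 :=
  if r.1 ≤ m then (if j ≠ r then 1 else 0) else (if j = r then 1 else 0)

lemma keyM_inj (n m : ℕ) (hm : m < n) (hodd : Odd m) (g : Fin n → ZMod 2)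
    (hg : ∀ j, ∑ r, g r * keyM n m r j = 0) (r : Fin n) : g r = 0 := by
  have key : ∀ r j, g r * keyM n m r j =
      (if r.1 ≤ m then g r else 0) + (if r = j then g r else 0) := by
    intro r j
    have := CharTwo.add_self_eq_zero (g r)
    simp only [keyM]
    by_cases h2 : r = j
    · subst h2
      by_cases h1 : r.1 ≤ m
      · simp [h1, this]
      · simp [h1]
    · by_cases h1 : r.1 ≤ m
      · simp [h1, h2, Ne.symm h2]
      · simp [h1, h2, Ne.symm h2]
  have h1 : ∀ j, g j = ∑ r : Fin n, (if r.1 ≤ m then g r else 0) := by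
    intro j
    have := hg j
    simp only [key, Finset.sum_add_distrib, Finset.sum_ite_eq', Finset.mem_univ, if_true] at this
    rw [CharTwo.add_eq_zero] at this
    exact this.symm
  generalize hs : ∑ r : Fin n, (if r.1 ≤ m then g r else 0) = s at h1
  simp only [h1] at hs
  rw [sum_le_card n m hm] at hs
  obtain ⟨t, ht⟩ := hodd
  rw [h1, ← hs, ht, show 2 * t + 1 + 1 = (t + 1) * 2 by ring, mul_smul, two_smul,
    CharTwo.add_self_eq_zero, smul_zero]

/-- The gains. -/
def kg (n m : ℕ) (j : Fin n) : Multiplicative (ZMod m) :=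
  Multiplicative.ofAdd (if j.1 ≤ m then 1 else 0)

lemma kg_prod (n m : ℕ) (hm : m < n) : ∏ j, kg n m j = Multiplicative.ofAdd 1 := by
  simp only [kg]
  rw [← ofAdd_sum, sum_le_card n m hm]
  simp

lemma kg_zero_ne (n m : ℕ) (hm : 3 ≤ m) (hn : 0 < n) : kg n m ⟨0, hn⟩ ≠ 1 := by
  have : Fact (1 < m) := ⟨by omega⟩
  simp [kg]

/-! ### Wheel -/

/-- The closed walk through the hub and `L` rim edges starting at `s`. -/
def wWalk (n : ℕ) (hn : 0 < n) (s L : ℕ) : List (wheel n).Step :=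
  ((Sum.inr (cyc n hn s), true) ::
    (List.range L).map (fun i => ((Sum.inl (cyc n hn (s + i)) : (wheel n).E), true))) ++
    [(Sum.inr (cyc n hn (s + L)), false)]

lemma wWalk_walk (n : ℕ) (hn : 0 < n) (s L : ℕ) :
    (wheel n).IsWalkFrom (Sum.inr ()) (Sum.inr ()) (wWalk n hn s L) := by
  have h := isWalk_range (wheel n) (fun i => Sum.inl (cyc n hn (s + i)))
    (fun i => ((Sum.inl (cyc n hn (s + i)) : (wheel n).E), true))
    (fun i => by simp [stepStart]) (fun i => by
      simp only [stepEnd, if_true]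
      exact congrArg Sum.inl (cyc_next n hn (s + i) hn)) L
  have h2 : (wheel n).IsWalkFrom (Sum.inr ()) (Sum.inl (cyc n hn (s + L)))
    ((Sum.inr (cyc n hn s), true) ::
    (List.range L).map (fun i => ((Sum.inl (cyc n hn (s + i)) : (wheel n).E), true))) := by
    refine IsWalkFrom.cons ?_ ?_
    · simp [stepStart]
    · simpa [stepEnd] using h
  exact isWalk_snoc (wheel n) (s := (Sum.inr (cyc n hn (s + L)), false)) h2 (by simp [stepStart])

lemma wWalk_edges (n : ℕ) (hn : 0 < n) (s L : ℕ) :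
    (wheel n).walkEdges (wWalk n hn s L) = (Sum.inr (cyc n hn s) ::
    (List.range L).map (fun i => (Sum.inl (cyc n hn (s + i)) : (wheel n).E))) ++
    [Sum.inr (cyc n hn (s + L))] := by
  simp [walkEdges, wWalk, Function.comp_def]

lemma wWalk_simple (n : ℕ) (hn : 0 < n) (s L : ℕ) (hL : 0 < L) (hLn : L < n) :
    (wheel n).IsSimpleClosed (wWalk n hn s L) := by
  have hne : cyc n hn s ≠ cyc n hn (s + L) := by
    intro h
    have := cyc_inj n hn s (i := 0) (j := L) (by omega) hLn h
    omega
  refine ⟨by simp [wWalk], ?_, ?_⟩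
  · rw [wWalk_edges, List.nodup_append]
    refine ⟨?_, by simp, ?_⟩
    · rw [List.nodup_cons]
      refine ⟨by simp, ?_⟩
      refine List.Nodup.map_on ?_ List.nodup_range
      intro i hi j hj h
      rw [List.mem_range] at hi hj
      exact cyc_inj n hn s (by omega) (by omega) (Sum.inl.inj h)
    · simp [hne]
  · have : (wWalk n hn s L).map (wheel n).stepStart = Sum.inr () ::
        (List.range (L + 1)).map (fun i => (Sum.inl (cyc n hn (s + i)) : (wheel n).V)) := by
      simp [wWalk, stepStart, Function.comp_def, List.range_succ]
    rw [this, List.nodup_cons]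
    refine ⟨by simp, ?_⟩
    refine List.Nodup.map_on ?_ List.nodup_range
    intro i hi j hj h
    rw [List.mem_range] at hi hj
    exact cyc_inj n hn s (by omega) (by omega) (Sum.inl.inj h)

/-- Gains on the wheel. -/
def wg (n m : ℕ) : (wheel n).E → Multiplicative (ZMod m) := Sum.elim (kg n m) (fun _ => 1)

lemma wWalk_gain (n m : ℕ) (hn : 0 < n) (s L : ℕ) :
    (wheel n).walkGain (wg n m) (wWalk n hn s L) =
      ∏ i ∈ Finset.range L, kg n m (cyc n hn (s + i)) := by
  simp [walkGain, wWalk, stepGain, wg, Function.comp_def, list_prod_range]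

/-- Triangle of the wheel. -/
def wTri (n : ℕ) (r : Fin n) : Set (wheel n).E :=
  {e | Sum.elim (fun j : Fin n => j = r)
      (fun j : Fin n => j = r ∨ j = ⟨(r.1 + 1) % n, Nat.mod_lt _ r.pos⟩) e}

/-- The basis of the wheel. -/
noncomputable def wBasis (n m : ℕ) (r : Fin n) : (wheel n).E →₀ ZMod 2 :=
  indicatorCycle (wheel n) (if r.1 ≤ m then wheelHamSet n r else wTri n r)

lemma wBasis_bal (n m : ℕ) (hm3 : 3 ≤ m) (hm : m < n) (r : Fin n) :
    (wheel n).IsBalancedCircleCycle (wg n m) (wBasis n m r) := by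
  have hn : 0 < n := by omega
  by_cases h : r.1 ≤ m
  · have hs := wWalk_simple n hn (r.1 + 1) (n - 1) (by omega) (by omega)
    refine ⟨wWalk n hn (r.1 + 1) (n - 1), hs, ?_, ?_⟩
    · rw [wBasis, if_pos h]
      refine orient_of _ _ _ _ (wWalk_walk _ _ _ _) hs.2.1 ?_
      rw [wWalk_edges]
      rintro (j | j)
      · simp only [wheelHamSet, Set.mem_ofPred_eq, Sum.elim_inl]
        rw [← cyc_ne_iff n hn r j]
        simp
      · simp only [wheelHamSet, Set.mem_ofPred_eq, Sum.elim_inr, cyc_last]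
        simp [cyc, or_comm]
    · rw [wWalk_gain]
      have h1 := cyc_prod n hn (r.1 + 1) (kg n m)
      have h3 : Finset.range n = Finset.range ((n - 1) + 1) := by congr 1; omega
      rw [kg_prod n m hm, h3, Finset.prod_range_succ, cyc_last] at h1
      have h2 : kg n m r = Multiplicative.ofAdd 1 := by simp [kg, h]
      rw [h2] at h1
      exact mul_eq_right.1 h1
  · have hs := wWalk_simple n hn r.1 1 (by omega) (by omega)
    refine ⟨wWalk n hn r.1 1, hs, ?_, ?_⟩
    · rw [wBasis, if_neg h]
      refine orient_of _ _ _ _ (wWalk_walk _ _ _ _) hs.2.1 ?_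
      rw [wWalk_edges]
      rintro (j | j)
      · simp [wTri, cyc_val]
      · simp [wTri, cyc_val]
        simp [cyc]
    · rw [wWalk_gain]
      simp [cyc_val, kg, h]

lemma boundary_apply (Γ : MGraph) [Fintype Γ.E] (c : Γ.E →₀ ZMod 2) (v : Γ.V) :
    Γ.boundary c v = ∑ e, ((if Γ.src e = v then c e else 0) + (if Γ.tgt e = v then c e else 0)) := by
  rw [boundary, Finsupp.lsum_apply, Finsupp.sum_fintype _ _ (by simp), Finsupp.finsetSum_apply]
  simp [Finsupp.single_apply]

lemma wBasis_basis (n m : ℕ) (hm3 : 3 ≤ m) (hm : m < n) (hodd : Odd m) :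
    (wheel n).IsCycleBasis (Set.range (wBasis n m)) := by
  refine basis_of (wheel n) (wBasis n m)
    (LinearMap.pi fun i => Finsupp.lapply (Sum.inl i)) ?_ ?_ ?_
  · intro r
    obtain ⟨l, _, h, _⟩ := wBasis_bal n m hm3 hm r
    exact mem_cycleSpace _ h
  · intro c hc h
    have h1 : ∀ i, c (Sum.inl i) = 0 := fun i => congrFun h i
    have h2 : ∀ i, c (Sum.inr i) = 0 := by
      intro i
      have h3 : (wheel n).boundary c (Sum.inl i) = 0 := by
        rw [LinearMap.mem_ker.1 hc]; rfl
      rw [boundary_apply] at h3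
      simpa [Fintype.sum_sum_type, h1] using h3
    ext (i | i)
    · exact h1 i
    · exact h2 i
  · rw [Fintype.linearIndependent_iff]
    intro g hg
    refine keyM_inj n m hm hodd g fun j => ?_
    have h1 := congrFun hg j
    simp only [Finset.sum_apply, Pi.smul_apply, Pi.zero_apply, smul_eq_mul] at h1
    rw [← h1]
    refine Finset.sum_congr rfl fun r _ => ?_
    congr 1
    simp only [keyM, wBasis, indicatorCycle, LinearMap.pi_apply, Finsupp.lapply_apply,
      Finsupp.equivFunOnFinite_symm_apply_apply]
    by_cases h : r.1 ≤ m
    · simp [h, wheelHamSet]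
    · simp [h, wTri]

lemma wheel_unbal (n m : ℕ) (hm3 : 3 ≤ m) (hm : m < n) :
    ¬ (wheel n).IsBalanced (wg n m) := by
  intro h
  have hn : 0 < n := by omega
  have h1 := h _ _ (wWalk_walk n hn 0 1) (wWalk_simple n hn 0 1 (by omega) (by omega))
  rw [wWalk_gain] at h1
  apply kg_zero_ne n m hm3 hn
  simpa [cyc] using h1

/-! ### Doubled circle -/

instance (n : ℕ) : Finite ((twoCircle n).E) := inferInstanceAs (Finite (Σ _ : Fin n, Fin 2))

/-- Hamiltonian walk of the doubled circle. -/
def tWalk (n : ℕ) (hn : 0 < n) (χ : Fin n → Fin 2) : List (twoCircle n).Step :=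
  (List.range n).map (fun i => ((⟨cyc n hn i, χ (cyc n hn i)⟩ : (twoCircle n).E), true))

lemma tWalk_walk (n : ℕ) (hn : 0 < n) (χ : Fin n → Fin 2) :
    (twoCircle n).IsWalkFrom (cyc n hn 0) (cyc n hn 0) (tWalk n hn χ) := by
  have h := isWalk_range (twoCircle n) (fun i => cyc n hn i)
    (fun i => ((⟨cyc n hn i, χ (cyc n hn i)⟩ : (twoCircle n).E), true))
    (fun i => by simp [stepStart]) (fun i => by
      simp only [stepEnd, if_true]
      exact cyc_next n hn i hn) n
  have h2 : cyc n hn n = cyc n hn 0 := by simp [cyc]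
  simp only [h2] at h
  exact h

lemma tWalk_simple (n : ℕ) (hn : 0 < n) (χ : Fin n → Fin 2) :
    (twoCircle n).IsSimpleClosed (tWalk n hn χ) := by
  have hinj : ∀ i ∈ List.range n, ∀ j ∈ List.range n, cyc n hn i = cyc n hn j → i = j := by
    intro i hi j hj h
    rw [List.mem_range] at hi hj
    exact cyc_inj n hn 0 hi hj (by simpa using h)
  refine ⟨by simp [tWalk]; omega, ?_, ?_⟩
  · rw [walkEdges, tWalk, List.map_map]
    refine List.Nodup.map_on ?_ List.nodup_range
    intro i hi j hj h
    exact hinj i hi j hj (congrArg Sigma.fst h)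
  · rw [tWalk, List.map_map]
    refine List.Nodup.map_on ?_ List.nodup_range
    intro i hi j hj h
    refine hinj i hi j hj ?_
    simpa [stepStart] using h

lemma tWalk_mem (n : ℕ) (hn : 0 < n) (χ : Fin n → Fin 2) (e : (twoCircle n).E) :
    e ∈ (twoCircle n).walkEdges (tWalk n hn χ) ↔ e.2 = χ e.1 := by
  obtain ⟨j, x⟩ := e
  simp only [walkEdges, tWalk, List.map_map, List.mem_map, List.mem_range, Function.comp_apply]
  constructor
  · rintro ⟨i, hi, h⟩
    cases h
    rfl
  · intro h
    subst h
    refine ⟨j.1, j.2, ?_⟩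
    rw [cyc_val]

/-- Gains on the doubled circle. -/
def tg (n m : ℕ) : (twoCircle n).E → Multiplicative (ZMod m) :=
  fun e => if e.2 = 1 then kg n m e.1 else 1

lemma tWalk_gain (n m : ℕ) (hn : 0 < n) (χ : Fin n → Fin 2) :
    (twoCircle n).walkGain (tg n m) (tWalk n hn χ) =
      ∏ j, if χ j = 1 then kg n m j else 1 := by
  rw [← cyc_prod n hn 0]
  simp [walkGain, tWalk, stepGain, tg, Function.comp_def, list_prod_range]

/-- A digon walk. -/
def dWalk (n : ℕ) (r : Fin n) : List (twoCircle n).Step :=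
  [(⟨r, 1⟩, true), (⟨r, 0⟩, false)]

lemma dWalk_walk (n : ℕ) (r : Fin n) : (twoCircle n).IsWalkFrom r r (dWalk n r) := by
  refine IsWalkFrom.cons (by simp [stepStart]) (IsWalkFrom.cons (by simp [stepStart, stepEnd]) ?_)
  simp only [stepEnd]
  exact IsWalkFrom.nil _

lemma dWalk_simple (n : ℕ) (hn : 2 ≤ n) (r : Fin n) :
    (twoCircle n).IsSimpleClosed (dWalk n r) := by
  refine ⟨by simp [dWalk], by simp [dWalk, walkEdges], ?_⟩
  have : r ≠ ⟨(r.1 + 1) % n, Nat.mod_lt _ r.pos⟩ := by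
    intro h
    have h1 : r.1 = (r.1 + 1) % n := congrArg Fin.val h
    have h2 := r.2
    by_cases h3 : r.1 + 1 < n
    · rw [Nat.mod_eq_of_lt h3] at h1
      omega
    · have h4 : r.1 + 1 = n := by omega
      rw [h4, Nat.mod_self] at h1
      omega
  simpa [dWalk, stepStart] using this

lemma dWalk_gain (n m : ℕ) (r : Fin n) :
    (twoCircle n).walkGain (tg n m) (dWalk n r) = kg n m r := by
  simp [walkGain, dWalk, stepGain, tg]

/-- Characteristic functions of the Hamiltonian circles. -/
def tχ (n : ℕ) : Option (Fin n) → Fin n → Fin 2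
  | none => fun _ => 0
  | some r => fun j => if j ≠ r then 1 else 0

/-- Basis edge sets. -/
def tSet (n m : ℕ) : Option (Fin n) → Set (twoCircle n).E
  | none => {e | e.2 = tχ n none e.1}
  | some r => if r.1 ≤ m then {e | e.2 = tχ n (some r) e.1} else {e | e.1 = r}

/-- The basis. -/
noncomputable def tBasis (n m : ℕ) (o : Option (Fin n)) : (twoCircle n).E →₀ ZMod 2 :=
  indicatorCycle (twoCircle n) (tSet n m o)

lemma tBasis_bal (n m : ℕ) (hm3 : 3 ≤ m) (hm : m < n) (o : Option (Fin n)) :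
    (twoCircle n).IsBalancedCircleCycle (tg n m) (tBasis n m o) := by
  have hn : 0 < n := by omega
  rcases o with _ | r
  · refine ⟨tWalk n hn (tχ n none), tWalk_simple _ _ _, ?_, ?_⟩
    · refine orient_of _ _ _ _ (tWalk_walk _ _ _) (tWalk_simple _ _ _).2.1 ?_
      intro e
      rw [tWalk_mem]
      rfl
    · rw [tWalk_gain]
      simp [tχ]
  · by_cases h : r.1 ≤ m
    · refine ⟨tWalk n hn (tχ n (some r)), tWalk_simple _ _ _, ?_, ?_⟩
      · refine orient_of _ _ _ _ (tWalk_walk _ _ _) (tWalk_simple _ _ _).2.1 ?_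
        intro e
        rw [tWalk_mem]
        simp [tSet, h]
      · rw [tWalk_gain]
        have h1 := kg_prod n m hm
        have h2 : kg n m r = Multiplicative.ofAdd 1 := by simp [kg, h]
        have h3 : ∏ j, kg n m j =
            (∏ j, if tχ n (some r) j = 1 then kg n m j else 1) * kg n m r := by
          have h4 : kg n m r = ∏ j, if j = r then kg n m j else 1 := by simp
          rw [h4, ← Finset.prod_mul_distrib]
          refine Finset.prod_congr rfl fun j _ => ?_
          by_cases hj : j = r <;> simp [tχ, hj]
        rw [h1, h2] at h3
        exact mul_eq_right.1 h3.symm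
    · refine ⟨dWalk n r, dWalk_simple n (by omega) r, ?_, ?_⟩
      · refine orient_of _ _ _ _ (dWalk_walk _ _) (dWalk_simple n (by omega) r).2.1 ?_
        rintro ⟨j, x⟩
        simp only [tSet, h, if_false, Set.mem_ofPred_eq, dWalk, walkEdges, List.map_cons,
          List.map_nil, List.mem_cons, List.not_mem_nil, or_false]
        constructor
        · rintro rfl
          fin_cases x
          · right; rfl
          · left; rfl
        · rintro (h | h) <;> cases h <;> rfl
      · rw [dWalk_gain]
        simp [kg, h]

/-- Coordinates on the cycle space of the doubled circle. -/
noncomputable def tρ (n : ℕ) (hn : 0 < n) :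
    ((twoCircle n).E →₀ ZMod 2) →ₗ[ZMod 2] (Option (Fin n) → ZMod 2) :=
  LinearMap.pi fun o => match o with
    | none => Finsupp.lapply (⟨cyc n hn 0, 0⟩ : (twoCircle n).E) +
        Finsupp.lapply (⟨cyc n hn 0, 1⟩ : (twoCircle n).E)
    | some i => Finsupp.lapply (⟨i, 1⟩ : (twoCircle n).E)

lemma tBasis_basis (n m : ℕ) (hm3 : 3 ≤ m) (hm : m < n) (hodd : Odd m) :
    (twoCircle n).IsCycleBasis (Set.range (tBasis n m)) := by
  have hn : 0 < n := by omega
  refine basis_of (twoCircle n) (tBasis n m) (tρ n hn) ?_ ?_ ?_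
  · intro r
    obtain ⟨l, _, h, _⟩ := tBasis_bal n m hm3 hm r
    exact mem_cycleSpace _ h
  · intro c hc h
    have h1 : ∀ i, c ⟨i, 1⟩ = 0 := fun i => congrFun h (some i)
    have h0 : c ⟨cyc n hn 0, 0⟩ = 0 := by
      have h2 : c ⟨cyc n hn 0, 0⟩ + c ⟨cyc n hn 0, 1⟩ = 0 := congrFun h none
      rwa [h1, add_zero] at h2
    have hstep : ∀ i, c ⟨cyc n hn (i + 1), 0⟩ + c ⟨cyc n hn i, 0⟩ = 0 := by
      intro i
      have h3 : (twoCircle n).boundary c (cyc n hn (i + 1)) = 0 := by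
        rw [LinearMap.mem_ker.1 hc]; rfl
      have hnext : ∀ x : Fin n, (⟨(x.1 + 1) % n, Nat.mod_lt _ x.pos⟩ : Fin n) =
          cyc n hn (i + 1) ↔ x = cyc n hn i := by
        intro x
        constructor
        · intro hx
          have h4 : (x.1 + 1) % n = (i + 1) % n := congrArg Fin.val hx
          have h5 : x.1 ≡ i [MOD n] := Nat.ModEq.add_right_cancel' 1 h4
          apply Fin.ext
          have h6 : x.1 % n = i % n := h5
          rw [Nat.mod_eq_of_lt x.2] at h6
          exact h6
        · rintro rfl
          exact cyc_next n hn i hn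
      rw [boundary_apply, Fintype.sum_sigma] at h3
      simpa [Fin.sum_univ_two, h1, hnext, Finset.sum_add_distrib] using h3
    have hall : ∀ i, c ⟨cyc n hn i, 0⟩ = 0 := by
      intro i
      induction i with
      | zero => exact h0
      | succ i ih =>
        have := hstep i
        rwa [ih, add_zero] at this
    ext ⟨i, x⟩
    fin_cases x
    · have := hall i.1
      rw [cyc_val] at this
      exact this
    · exact h1 i
  · rw [Fintype.linearIndependent_iff]
    intro g hg
    have hsome : ∀ r, g (some r) = 0 := by
      refine keyM_inj n m hm hodd (fun r => g (some r)) fun j => ?_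
      have h1 := congrFun hg (some j)
      simp only [Finset.sum_apply, Pi.smul_apply, Pi.zero_apply, smul_eq_mul] at h1
      rw [Fintype.sum_option] at h1
      have h2 : tρ n hn (tBasis n m none) (some j) = 0 := by
        simp [tρ, tBasis, indicatorCycle, tSet, tχ]
      rw [h2, mul_zero, zero_add] at h1
      rw [← h1]
      refine Finset.sum_congr rfl fun r _ => ?_
      congr 1
      simp only [keyM, tρ, tBasis, indicatorCycle, LinearMap.pi_apply, Finsupp.lapply_apply,
        Finsupp.equivFunOnFinite_symm_apply_apply]
      by_cases h : r.1 ≤ m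
      · by_cases hj : j = r <;> simp [h, tSet, tχ, hj]
      · simp [h, tSet]
    intro o
    rcases o with _ | r
    · have h1 := congrFun hg none
      simp only [Finset.sum_apply, Pi.smul_apply, Pi.zero_apply, smul_eq_mul] at h1
      rw [Fintype.sum_option] at h1
      have h2 : tρ n hn (tBasis n m none) none = 1 := by
        simp [tρ, tBasis, indicatorCycle, tSet, tχ]
      simpa [h2, hsome] using h1
    · exact hsome r

lemma two_unbal (n m : ℕ) (hm3 : 3 ≤ m) (hm : m < n) :
    ¬ (twoCircle n).IsBalanced (tg n m) := by
  intro h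
  have hn : 0 < n := by omega
  have h1 := h _ _ (dWalk_walk n ⟨0, hn⟩) (dWalk_simple n (by omega) _)
  rw [dWalk_gain] at h1
  exact kg_zero_ne n m hm3 hn h1

lemma wheelHam_eq (n m : ℕ) (hm : n ≤ m + 1) : wheelHamBasis n = Set.range (wBasis n m) := by
  ext c
  simp only [wheelHamBasis, Set.mem_ofPred_eq, Set.mem_range]
  refine exists_congr fun r => ?_
  have := r.2
  rw [wBasis, if_pos (by omega)]
  exact eq_comm

end MGraph

/-- For `k ≥ 2`, if `𝒢` contains one of `ℤ₃, ℤ₅, …, ℤ_{2k−1}`,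
then `W_{2k}` and `2C_{2k}` are bad with respect to `𝒢`.  In particular, if
`ℤ_{2k−1} ∈ 𝒢` then the basis of `Z₁(W_{2k}; ℤ₂)` consisting of the `2k`
Hamiltonian circles can be balanced in an unbalanced gain graph on `W_{2k}` with
gain group `ℤ_{2k−1}`, and similarly for `2C_{2k}`. -/
theorem even_wheels_and_double_circles_bad (𝒢 : GroupClass) (k : ℕ) (hk : 2 ≤ k)
    (h : ∃ m : ℕ, Odd m ∧ 3 ≤ m ∧ m ≤ 2 * k - 1 ∧
      𝒢 (Multiplicative (ZMod m)) inferInstance) :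
    ((¬ (MGraph.wheel (2 * k)).CircleTestValidFor 𝒢) ∧
      (¬ (MGraph.twoCircle (2 * k)).CircleTestValidFor 𝒢)) ∧
    (𝒢 (Multiplicative (ZMod (2 * k - 1))) inferInstance →
      (∃ g : (MGraph.wheel (2 * k)).E → Multiplicative (ZMod (2 * k - 1)),
        (MGraph.wheel (2 * k)).IsCycleBasis (MGraph.wheelHamBasis (2 * k)) ∧
        (∀ c ∈ MGraph.wheelHamBasis (2 * k),
          (MGraph.wheel (2 * k)).IsBalancedCircleCycle g c) ∧
        ¬ (MGraph.wheel (2 * k)).IsBalanced g) ∧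
      (∃ g : (MGraph.twoCircle (2 * k)).E → Multiplicative (ZMod (2 * k - 1)),
        ∃ B, (MGraph.twoCircle (2 * k)).IsCycleBasis B ∧
          (∀ c ∈ B, (MGraph.twoCircle (2 * k)).IsBalancedCircleCycle g c) ∧
          ¬ (MGraph.twoCircle (2 * k)).IsBalanced g)) := by
  constructor
  · obtain ⟨m, hodd, hm3, hm, hG⟩ := h
    constructor
    · intro hv
      refine MGraph.wheel_unbal (2 * k) m hm3 (by omega)
        (hv _ hG _ ⟨_, MGraph.wBasis_basis (2 * k) m hm3 (by omega) hodd, ?_⟩)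
      rintro _ ⟨r, rfl⟩
      exact MGraph.wBasis_bal (2 * k) m hm3 (by omega) r
    · intro hv
      refine MGraph.two_unbal (2 * k) m hm3 (by omega)
        (hv _ hG _ ⟨_, MGraph.tBasis_basis (2 * k) m hm3 (by omega) hodd, ?_⟩)
      rintro _ ⟨r, rfl⟩
      exact MGraph.tBasis_bal (2 * k) m hm3 (by omega) r
  · intro _
    have hodd : Odd (2 * k - 1) := ⟨k - 1, by omega⟩
    have hm3 : 3 ≤ 2 * k - 1 := by omega
    have hm : 2 * k - 1 < 2 * k := by omega
    constructor
    · rw [MGraph.wheelHam_eq (2 * k) (2 * k - 1) (by omega)]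
      refine ⟨_, MGraph.wBasis_basis (2 * k) _ hm3 hm hodd, ?_, MGraph.wheel_unbal _ _ hm3 hm⟩
      rintro _ ⟨r, rfl⟩
      exact MGraph.wBasis_bal (2 * k) _ hm3 hm r
    · refine ⟨_, _, MGraph.tBasis_basis (2 * k) _ hm3 hm hodd, ?_, MGraph.two_unbal _ _ hm3 hm⟩
      rintro _ ⟨r, rfl⟩
      exact MGraph.tBasis_bal (2 * k) _ hm3 hm r
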